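/- Fix a block assignment β : Fin N → Fin n and let S be a block-Stäckel matrix with twice differentiable entries; set α^r = (S^{-1})_{1,r}. For each r let V_r : ℝ^N → ℝ be twice differentiable and depend only on the r-block coordinates, and define V = Σ_r α^r V_r. Then for all i, j ∈ Fin N lying in different blocks (β(i) = r, β(j) = s, r ≠ s) and all q ∈ ℝ^N: α^r(q) α^s(q) ∂_i∂_j V(q) − α^r(q) (∂_i α^s(q)) (∂_j V(q)) − α^s(q) (∂_j α^r(q)) (∂_i V(q)) = 0 (the Bertrand–Darboux-type block equations for the potential). -/

import Mathlib

open scoped BigOperators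

section StackelSystem

variable {E ι : Type*} [NormedAddCommGroup E] [NormedSpace ℝ E] [Fintype ι] [DecidableEq ι]

/-- The determinant of a matrix with differentiable entries is differentiable. -/
theorem differentiable_matrix_det {A : E → Matrix ι ι ℝ}
    (hA : ∀ a b, Differentiable ℝ fun q => A q a b) :
    Differentiable ℝ fun q => (A q).det := by
  simp only [Matrix.det_apply']
  fun_prop

/-- The inverse of an invertible matrix with differentiable entries has differentiable entries. -/
theorem differentiable_matrix_inv_apply {A : E → Matrix ι ι ℝ}
    (hA : ∀ a b, Differentiable ℝ fun q => A q a b) (hinv : ∀ q, IsUnit (A q).det) (a b : ι) :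
    Differentiable ℝ fun q => (A q)⁻¹ a b := by
  have hadj : Differentiable ℝ fun q => (A q).adjugate a b := by
    simp only [Matrix.adjugate_apply]
    refine differentiable_matrix_det fun c d => ?_
    by_cases h : c = b
    · subst h
      simp
    · simpa [Matrix.updateRow_ne h] using hA c d
  simp only [Matrix.inv_def, Matrix.smul_apply, Ring.inverse_eq_inv', smul_eq_mul]
  exact ((differentiable_matrix_det hA).inv fun q => (hinv q).ne_zero).mul hadj

/-- If `A u = f` and, in the direction `v`, only the `r`-th row of the system varies, then the
derivative of `u` is proportional to the `r`-th column of `A⁻¹`. -/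
theorem fderiv_solution_apply {A : E → Matrix ι ι ℝ} {u f : ι → E → ℝ} {q v : E} {r : ι}
    (hA : ∀ a b, Differentiable ℝ fun q => A q a b) (hinv : IsUnit (A q).det)
    (hu : ∀ a, Differentiable ℝ (u a))
    (hsys : ∀ a q, ∑ m, A q a m * u m q = f a q)
    (hAr : ∀ a b, a ≠ r → fderiv ℝ (fun q => A q a b) q v = 0)
    (hfr : ∀ a, a ≠ r → fderiv ℝ (f a) q v = 0) (a : ι) :
    fderiv ℝ (u a) q v = (A q)⁻¹ a r *
      (fderiv ℝ (f r) q v - ∑ m, fderiv ℝ (fun q => A q r m) q v * u m q) := by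
  have hderiv (k : ι) : ∑ m, A q k m * fderiv ℝ (u m) q v =
      fderiv ℝ (f k) q v - ∑ m, fderiv ℝ (fun q => A q k m) q v * u m q := by
    have hf : f k = fun q => ∑ m, A q k m * u m q := funext fun q => (hsys k q).symm
    have hd (m : ι) : DifferentiableAt ℝ (fun q => A q k m * u m q) q := (hA k m q).mul (hu m q)
    rw [hf, fderiv_fun_sum fun m _ => hd m, eq_sub_iff_add_eq,
      ← Finset.sum_add_distrib, sum_apply]
    refine Finset.sum_congr rfl fun m _ => ?_
    rw [fderiv_fun_mul (hA k m q) (hu m q)]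
    simp only [add_apply, smul_apply, smul_eq_mul]
    ring
  have hmul : (A q).mulVec (fun m => fderiv ℝ (u m) q v) = Pi.single r
      (fderiv ℝ (f r) q v - ∑ m, fderiv ℝ (fun q => A q r m) q v * u m q) := by
    ext k
    rw [Matrix.mulVec, dotProduct, hderiv k]
    by_cases hk : k = r
    · subst hk
      simp
    · simp [hk, hfr k hk, hAr k _ hk]
  have hsolve := congrArg (fun w => (A q)⁻¹.mulVec w a) hmul
  simpa [Matrix.mulVec_mulVec, Matrix.nonsing_inv_mul _ hinv, mul_comm] using hsolve

/-- If `∂_v f` vanishes identically then so does `∂_v ∂_w f`. -/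
theorem fderiv_fderiv_apply_eq_zero {f : E → ℝ} (hf : ContDiff ℝ 2 f) {v : E}
    (hv : ∀ q, fderiv ℝ f q v = 0) (q w : E) :
    fderiv ℝ (fun q' => fderiv ℝ f q' w) q v = 0 := by
  have hd : DifferentiableAt ℝ (fderiv ℝ f) q :=
    (hf.fderiv_right (m := 1) (by norm_num)).differentiable (by norm_num) q
  have hsymm : IsSymmSndFDerivAt ℝ f q := hf.contDiffAt.isSymmSndFDerivAt (by simp)
  have happly (x y : E) : fderiv ℝ (fun q' => fderiv ℝ f q' x) q y
      = fderiv ℝ (fderiv ℝ f) q y x := by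
    rw [fderiv_clm_apply hd (differentiableAt_const x)]
    simp
  rw [happly, hsymm.eq, ← happly]
  simp [hv]

end StackelSystem

/-- Bertrand–Darboux-type block equations for the potential:
if `S` is a block-Stäckel matrix with twice differentiable entries,
`α^r = (S⁻¹)_{1,r}`, each `V_r` is twice differentiable and depends only on
the `r`-block, and `V = ∑ r α^r V_r`, then for all coordinates `i`, `j` in
different blocks,
`α^{β(i)} α^{β(j)} ∂_i∂_j V − α^{β(i)} (∂_i α^{β(j)})(∂_j V)
  − α^{β(j)} (∂_j α^{β(i)})(∂_i V) = 0`. -/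
theorem stmt_11 (N n : ℕ) [NeZero n] (β : Fin N → Fin n) (hβ : Function.Surjective β)
    (S : (Fin N → ℝ) → Matrix (Fin n) (Fin n) ℝ)
    (hSdiff : ∀ r j : Fin n, ContDiff ℝ 2 (fun q => S q r j))
    (hSinv : ∀ q, IsUnit (S q).det)
    (hSblock : ∀ (r j : Fin n) (i : Fin N), β i ≠ r →
      ∀ q : Fin N → ℝ, fderiv ℝ (fun q' => S q' r j) q (Pi.single i 1) = 0)
    (α : Fin n → (Fin N → ℝ) → ℝ)
    (hα : ∀ r q, α r q = (S q)⁻¹ 0 r)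
    (Vr : Fin n → (Fin N → ℝ) → ℝ)
    (hVrdiff : ∀ r, ContDiff ℝ 2 (Vr r))
    (hVrblock : ∀ (r : Fin n) (i : Fin N), β i ≠ r →
      ∀ q : Fin N → ℝ, fderiv ℝ (Vr r) q (Pi.single i 1) = 0)
    (V : (Fin N → ℝ) → ℝ)
    (hV : ∀ q, V q = ∑ r : Fin n, α r q * Vr r q) :
    ∀ (i j : Fin N), β i ≠ β j → ∀ q : Fin N → ℝ,
      α (β i) q * α (β j) q
          * fderiv ℝ (fun q' => fderiv ℝ V q' (Pi.single j 1)) q (Pi.single i 1)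
        - α (β i) q * fderiv ℝ (α (β j)) q (Pi.single i 1)
            * fderiv ℝ V q (Pi.single j 1)
        - α (β j) q * fderiv ℝ (α (β i)) q (Pi.single j 1)
            * fderiv ℝ V q (Pi.single i 1) = 0 := by
  intro i j hij q
  have hSd (a b : Fin n) : Differentiable ℝ fun q => S q a b :=
    (hSdiff a b).differentiable (by norm_num)
  have hVd (a : Fin n) : Differentiable ℝ (Vr a) := (hVrdiff a).differentiable (by norm_num)
  have hDd := differentiable_matrix_inv_apply hSd hSinv
  have hα' (r : Fin n) : α r = fun q => (S q)⁻¹ 0 r := funext (hα r)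
  -- `U = S⁻¹ (V_r)_r`, whose first entry is `V`
  let U : Fin n → (Fin N → ℝ) → ℝ := fun a q => ∑ k, (S q)⁻¹ a k * Vr k q
  have hVU : V = U 0 := by
    funext q
    simp only [hV, hα, U]
  have hUd (a : Fin n) : Differentiable ℝ (U a) :=
    Differentiable.fun_sum fun k _ => (hDd a k).mul (hVd k)
  have hUsys (a : Fin n) (q : Fin N → ℝ) : ∑ m, S q a m * U m q = Vr a q := by
    have h : (S q).mulVec ((S q)⁻¹.mulVec fun k => Vr k q) a = Vr a q := by
      rw [Matrix.mulVec_mulVec, Matrix.mul_nonsing_inv _ (hSinv q), Matrix.one_mulVec]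
    exact h
  let g : Fin N → (Fin N → ℝ) → ℝ := fun l q => fderiv ℝ (Vr (β l)) q (Pi.single l 1) -
    ∑ m, fderiv ℝ (fun q => S q (β l) m) q (Pi.single l 1) * U m q
  have hU (l : Fin N) (a : Fin n) (q : Fin N → ℝ) :
      fderiv ℝ (U a) q (Pi.single l 1) = (S q)⁻¹ a (β l) * g l q :=
    fderiv_solution_apply hSd (hSinv q) hUd hUsys
      (fun a b ha => hSblock a b l ha.symm q) (fun a ha => hVrblock a l ha.symm q) a
  have hD (l : Fin N) (a t : Fin n) (q : Fin N → ℝ) :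
      fderiv ℝ (fun q => (S q)⁻¹ a t) q (Pi.single l 1) = (S q)⁻¹ a (β l) *
        -∑ m, fderiv ℝ (fun q => S q (β l) m) q (Pi.single l 1) * (S q)⁻¹ m t := by
    have h := fderiv_solution_apply (u := fun m q => (S q)⁻¹ m t)
      (f := fun k _ => (1 : Matrix (Fin n) (Fin n) ℝ) k t) hSd (hSinv q) (fun m => hDd m t)
      (fun k q => by rw [← Matrix.mul_nonsing_inv _ (hSinv q), Matrix.mul_apply])
      (fun a b ha => hSblock a b l ha.symm q) (fun k _ => by simp) a
    simpa using h
  have hfd {f : (Fin N → ℝ) → ℝ} (hf : ContDiff ℝ 2 f) (w : Fin N → ℝ) :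
      Differentiable ℝ fun q => fderiv ℝ f q w :=
    ((hf.fderiv_right (m := 1) (by norm_num)).differentiable (by norm_num)).clm_apply
      (differentiable_const w)
  have hsum (m : Fin n) : Differentiable ℝ
      fun q => fderiv ℝ (fun q => S q (β j) m) q (Pi.single j 1) * U m q :=
    (hfd (hSdiff (β j) m) _).mul (hUd m)
  have hgd : Differentiable ℝ (g j) :=
    (hfd (hVrdiff (β j)) _).sub (Differentiable.fun_sum fun m _ => hsum m)
  have hg : fderiv ℝ (g j) q (Pi.single i 1) =
      (-∑ m, fderiv ℝ (fun q => S q (β j) m) q (Pi.single j 1) * (S q)⁻¹ m (β i)) * g i q := by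
    have hterm (m : Fin n) :
        fderiv ℝ (fun q => fderiv ℝ (fun q => S q (β j) m) q (Pi.single j 1) * U m q) q
          (Pi.single i 1) =
        fderiv ℝ (fun q => S q (β j) m) q (Pi.single j 1) * (S q)⁻¹ m (β i) * g i q := by
      rw [fderiv_fun_mul (hfd (hSdiff (β j) m) _ q) (hUd m q)]
      simp only [add_apply, smul_apply, smul_eq_mul,
        hU i m q, fderiv_fderiv_apply_eq_zero (hSdiff (β j) m) (hSblock (β j) m i hij)]
      ring
    simp only [g]
    rw [fderiv_fun_sub (hfd (hVrdiff (β j)) _ q)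
      (Differentiable.fun_sum (fun m _ => hsum m) q), fderiv_fun_sum fun m _ => hsum m q]
    simp only [sub_apply, sum_apply, hterm,
      fderiv_fderiv_apply_eq_zero (hVrdiff (β j)) (hVrblock (β j) i hij), ← Finset.sum_mul]
    simp only [g]
    ring
  have hVj : (fun q => fderiv ℝ V q (Pi.single j 1)) = fun q => (S q)⁻¹ 0 (β j) * g j q := by
    funext q
    rw [hVU, hU]
  rw [hVj, fderiv_fun_mul (hDd 0 (β j) q) (hgd q), hVU, hU, hU, hα', hα', hD j]
  simp only [add_apply, smul_apply, smul_eq_mul, hg]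
  ring
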